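/- Suppose CAV i−1 comes from a conflicting road and exits the merging zone at time t_{i-1}^m + S/v_{i-1}^m, with v_{i-1}^m > 0 and S > 0, and let u_max > 0, L > 0. Let v : ℝ → ℝ be differentiable on [t_0, t_m] with t_0 < t_m, v(t_0) = v_0 ≥ 0, v'(t) ≤ u_max for all t ∈ [t_0, t_m], ∫_{t_0}^{t_m} v(t) dt = L, and suppose the lateral-collision constraint holds: t_m ≥ t_{i-1}^m + S/v_{i-1}^m. Then t_m ≥ max(t_{i-1}^m + S/v_{i-1}^m, t_0 + (√(2·L·u_max + v_0²) − v_0)/u_max). (This is the lower bound of Theorem 1 in the case i−1 ∈ C_i, when the speed limit is not reached.) -/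

import Mathlib

/-- A function whose derivative is at most `C` on `[a, b]` grows at most linearly with slope `C`. -/
theorem le_add_mul_of_hasDerivAt_le {f f' : ℝ → ℝ} {a b C : ℝ}
    (hf : ∀ t ∈ Set.Icc a b, HasDerivAt f (f' t) t) (hC : ∀ t ∈ Set.Icc a b, f' t ≤ C)
    {t : ℝ} (ht : t ∈ Set.Icc a b) : f t ≤ f a + C * (t - a) := by
  have h := (convex_Icc a b).image_sub_le_mul_sub_of_deriv_le (f := f) (C := C)
    (fun x hx => (hf x hx).continuousAt.continuousWithinAt)
    (fun x hx => (hf x (interior_subset hx)).differentiableAt.differentiableWithinAt)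
    (fun x hx => by
      rw [(hf x (interior_subset hx)).deriv]
      exact hC x (interior_subset hx))
    a ⟨le_rfl, ht.1.trans ht.2⟩ t ht ht.1
  linarith

/-- The integral over `[a, b]` of a function with derivative at most `C` is at most that of the
affine function with the same initial value and slope `C`. -/
theorem integral_le_of_hasDerivAt_le {f f' : ℝ → ℝ} {a b C : ℝ} (hab : a ≤ b)
    (hf : ∀ t ∈ Set.Icc a b, HasDerivAt f (f' t) t) (hC : ∀ t ∈ Set.Icc a b, f' t ≤ C) :
    ∫ t in a..b, f t ≤ f a * (b - a) + C * (b - a) ^ 2 / 2 := by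
  have hcont : ContinuousOn f (Set.Icc a b) :=
    fun x hx => (hf x hx).continuousAt.continuousWithinAt
  have hg : Continuous fun t : ℝ => f a + C * (t - a) := by fun_prop
  calc ∫ t in a..b, f t ≤ ∫ t in a..b, (f a + C * (t - a)) :=
        intervalIntegral.integral_mono_on hab (hcont.intervalIntegrable_of_Icc hab)
          (hg.intervalIntegrable a b) fun t ht => le_add_mul_of_hasDerivAt_le hf hC ht
    _ = f a * (b - a) + C * (b - a) ^ 2 / 2 := by
        have hderiv : ∀ t ∈ Set.uIcc a b,
            HasDerivAt (fun s : ℝ => f a * (s - a) + C * (s - a) ^ 2 / 2)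
              (f a + C * (t - a)) t := fun t _ => by
          have h := (hasDerivAt_id' t).sub_const a
          refine ((h.const_mul (f a)).add (((h.pow 2).const_mul C).div_const 2)).congr_deriv ?_
          push_cast
          ring
        rw [intervalIntegral.integral_eq_sub_of_hasDerivAt hderiv (hg.intervalIntegrable a b)]
        ring

/-- Lower bound of Theorem 1 in the case `i−1 ∈ C_i` (conflicting road, speed
limit not reached): the MZ entry time `t_m` is at least the maximum of the
lateral-collision bound `t_{i-1}^m + S/v_{i-1}^m` and the maximal-acceleration
bound `t₀ + (√(2·L·umax + v₀²) − v₀)/umax`. -/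
theorem stmt_14 (tim1 vim1 S umax L t0 tm v0 : ℝ) (v v' : ℝ → ℝ)
    (hvim1 : 0 < vim1) (hS : 0 < S) (hu : 0 < umax) (hL : 0 < L)
    (ht : t0 < tm) (hv0nonneg : 0 ≤ v0) (hv0 : v t0 = v0)
    (hderiv : ∀ t ∈ Set.Icc t0 tm, HasDerivAt v (v' t) t)
    (hubound : ∀ t ∈ Set.Icc t0 tm, v' t ≤ umax)
    (hint : ∫ t in t0..tm, v t = L)
    (hlateral : tim1 + S / vim1 ≤ tm) :
    max (tim1 + S / vim1)
      (t0 + (Real.sqrt (2 * L * umax + v0 ^ 2) - v0) / umax) ≤ tm := by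
  refine max_le hlateral ?_
  have hdist := integral_le_of_hasDerivAt_le ht.le hderiv hubound
  rw [hint, hv0] at hdist
  have hsqrt : Real.sqrt (2 * L * umax + v0 ^ 2) ≤ umax * (tm - t0) + v0 := by
    refine Real.sqrt_le_iff.mpr ⟨?_, ?_⟩
    · have := mul_pos hu (sub_pos.mpr ht)
      linarith
    · linarith [mul_le_mul_of_nonneg_left hdist hu.le]
  have hdiv : (Real.sqrt (2 * L * umax + v0 ^ 2) - v0) / umax ≤ tm - t0 := by
    rw [div_le_iff₀ hu]
    linarith
  linarith
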